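/- arXiv:0704.2094 — 2 statements merged into one kernel-verified Lean document; each statement's English description precedes it below -/
import Mathlib

section
/- With φ⁰ the coarse hat function (mesh h) centered at a vertex p of the type-1 triangulation and φ¹_v the fine hat functions (mesh h/2), the Dirichlet inner products are: ⟨φ⁰, φ¹_v⟩_s = 1/2 for v = p ± (h/2,0) and v = p ± (0,h/2); ⟨φ⁰, φ¹_v⟩_s = 1 for v = p ± (h/2,h/2); ⟨φ⁰, φ¹_v⟩_s = −1/2 for v = p ± (h,0), p ± (0,h), p ± (h,h/2), p ± (h/2,h); ⟨φ⁰, φ¹_v⟩_s = −1 for v = p ± (h/2,−h/2); and ⟨φ⁰, φ¹_v⟩_s = 0 for v = p ± (h,h) and all other half-grid vertices v. -/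
noncomputable section
open MeasureTheory

/-- The piecewise-linear hat (Courant) function of mesh size `h` centered at `p`
on the type-1 (three-direction) triangulation of ℝ²: it is supported on the
hexagon with vertices p + (−h,−h),(0,−h),(h,0),(h,h),(0,h),(−h,0), linear on
each triangle, equals 1 at `p` and 0 at all other grid points. -/
def hat (h : ℝ) (p x : ℝ × ℝ) : ℝ :=
  max 0 (1 - (max |x.1 - p.1| (max |x.2 - p.2| |(x.1 - p.1) - (x.2 - p.2)|)) / h)

/-- Partial derivative in the x-direction. -/
def pdx (f : (ℝ × ℝ) → ℝ) (x : ℝ × ℝ) : ℝ := fderiv ℝ f x (1, 0)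

/-- Partial derivative in the y-direction. -/
def pdy (f : (ℝ × ℝ) → ℝ) (x : ℝ × ℝ) : ℝ := fderiv ℝ f x (0, 1)

/-- The Dirichlet inner product ⟨u,v⟩ₛ = ∫_{ℝ²} ∇u·∇v. -/
def dirR (u v : (ℝ × ℝ) → ℝ) : ℝ :=
  ∫ x : ℝ × ℝ, (pdx u x * pdx v x + pdy u x * pdy v x)

/-- The table of Dirichlet inner products ⟨φ⁰, φ¹_{p + (a·h/2, b·h/2)}⟩ₛ of the
coarse hat at p (mesh h) with fine hats (mesh h/2) at half-grid offsets (a,b).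
(The value 2 at the center offset (0,0) is from Lemma 3.1 of the paper.) -/
def hatCoef (a b : ℤ) : ℝ :=
  if (a, b) = ((0 : ℤ), (0 : ℤ)) then 2
  else if (a, b) ∈ ({(1, 0), (-1, 0), (0, 1), (0, -1)} : Finset (ℤ × ℤ)) then 1 / 2
  else if (a, b) ∈ ({(1, 1), (-1, -1)} : Finset (ℤ × ℤ)) then 1
  else if (a, b) ∈ ({(2, 0), (-2, 0), (0, 2), (0, -2),
                     (2, 1), (-2, -1), (1, 2), (-1, -2)} : Finset (ℤ × ℤ)) then -1 / 2
  else if (a, b) ∈ ({(1, -1), (-1, 1)} : Finset (ℤ × ℤ)) then -1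
  else 0

open Filter Topology

/-- The indicator of the open interval `(c, c + l)`. -/
def pulse (l c s : ℝ) : ℝ := if c < s ∧ s < c + l then 1 else 0

/-- The indicator of the open square of side `l` with lower left corner `(c, d)`. -/
def squareInd (l c d : ℝ) (z : ℝ × ℝ) : ℝ := pulse l c z.1 * pulse l d z.2

/-- Whether the cell `[m, m + 1]` lies in `[i, i + 2]`. -/
def cellOverlap (i m : ℤ) : ℝ := if m = i ∨ m = i + 1 then 1 else 0

lemma pulse_mul_pulse {k : ℝ} (hk : 0 < k) (q s : ℝ) (i m : ℤ) :
    pulse (2 * k) (q + i * k) s * pulse k (q + m * k) s =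
      cellOverlap i m * pulse k (q + m * k) s := by
  unfold cellOverlap
  split_ifs with hm
  · rcases hm with rfl | rfl
    · unfold pulse
      split_ifs <;> grind
    · unfold pulse
      push_cast
      split_ifs <;> grind
  · have hsep : m + 1 ≤ i ∨ i + 2 ≤ m := by omega
    unfold pulse
    rcases hsep with hm' | hm'
    · have h1 : ((m : ℝ) + 1) * k ≤ i * k :=
        mul_le_mul_of_nonneg_right (by exact_mod_cast hm') hk.le
      split_ifs <;> grind
    · have h1 : ((i : ℝ) + 2) * k ≤ m * k :=
        mul_le_mul_of_nonneg_right (by exact_mod_cast hm') hk.le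
      split_ifs <;> grind

lemma squareInd_mul_squareInd {k : ℝ} (hk : 0 < k) (q r : ℝ) (i j m n : ℤ) (z : ℝ × ℝ) :
    squareInd (2 * k) (q + i * k) (r + j * k) z * squareInd k (q + m * k) (r + n * k) z =
      cellOverlap i m * cellOverlap j n * squareInd k (q + m * k) (r + n * k) z := by
  have h1 := pulse_mul_pulse hk q z.1 i m
  have h2 := pulse_mul_pulse hk r z.2 j n
  unfold squareInd
  linear_combination (pulse (2 * k) (r + j * k) z.2 * pulse k (r + n * k) z.2) * h1 +
    cellOverlap i m * pulse k (q + m * k) z.1 * h2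

lemma pulse_eq_indicator (l c : ℝ) :
    pulse l c = (Set.Ioo c (c + l)).indicator fun _ => (1 : ℝ) := by
  ext s
  simp [pulse, Set.indicator, Set.mem_Ioo]

lemma pulse_sub_of_neg {l c s : ℝ} (hs : s - c < 0) :
    pulse l (c - l) s = if -l < s - c then 1 else 0 := by
  unfold pulse
  congr 1
  exact propext ⟨fun h => by linarith [h.1], fun h => ⟨by linarith, by linarith⟩⟩

lemma pulse_sub_of_pos {l c s : ℝ} (hs : 0 < s - c) : pulse l (c - l) s = 0 :=
  if_neg fun h => by linarith [h.2]

lemma pulse_of_neg {l c s : ℝ} (hs : s - c < 0) : pulse l c s = 0 :=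
  if_neg fun h => by linarith [h.1]

lemma pulse_of_pos {l c s : ℝ} (hs : 0 < s - c) :
    pulse l c s = if s - c < l then 1 else 0 := by
  unfold pulse
  congr 1
  exact propext ⟨fun h => by linarith [h.2], fun h => ⟨by linarith, by linarith⟩⟩

lemma integrable_pulse (l c : ℝ) : Integrable (pulse l c) := by
  rw [pulse_eq_indicator]
  exact (integrable_indicator_iff measurableSet_Ioo).2 (integrableOn_const (by simp))

lemma integral_pulse {l : ℝ} (hl : 0 ≤ l) (c : ℝ) : ∫ s, pulse l c s = l := by
  rw [pulse_eq_indicator, integral_indicator measurableSet_Ioo]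
  simp [hl]

lemma integrable_squareInd (l c d : ℝ) : Integrable (squareInd l c d) :=
  (integrable_pulse l c).mul_prod (integrable_pulse l d)

lemma integral_squareInd {l : ℝ} (hl : 0 ≤ l) (c d : ℝ) : ∫ z, squareInd l c d z = l ^ 2 := by
  have := integral_prod_mul (μ := (volume : Measure ℝ)) (ν := (volume : Measure ℝ))
    (pulse l c) (pulse l d)
  rw [integral_pulse hl, integral_pulse hl] at this
  rw [sq]
  exact this

/-- The shear `(x, y) ↦ (x, x - y)`. -/
def shearX : (ℝ × ℝ) ≃ᵐ (ℝ × ℝ) where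
  toFun z := (z.1, z.1 - z.2)
  invFun z := (z.1, z.1 - z.2)
  left_inv z := by simp
  right_inv z := by simp
  measurable_toFun := by simp only [Equiv.coe_fn_mk]; fun_prop
  measurable_invFun := by simp only [Equiv.coe_fn_symm_mk]; fun_prop

/-- The shear `(x, y) ↦ (y, x - y)`. -/
def shearY : (ℝ × ℝ) ≃ᵐ (ℝ × ℝ) where
  toFun z := (z.2, z.1 - z.2)
  invFun z := (z.1 + z.2, z.1)
  left_inv z := by simp
  right_inv z := by simp
  measurable_toFun := by simp only [Equiv.coe_fn_mk]; fun_prop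
  measurable_invFun := by simp only [Equiv.coe_fn_symm_mk]; fun_prop

lemma measurePreserving_shearX : MeasurePreserving shearX := by
  have h1 : MeasurePreserving (fun z : ℝ × ℝ => (z.1, z.1 - z.2)) (volume.prod volume)
      (volume.prod volume) :=
    (MeasurePreserving.id volume).skew_product (g := fun x y : ℝ => x - y) (by fun_prop)
      (ae_of_all _ fun x => (Measure.measurePreserving_sub_left volume x).map_eq)
  exact h1

lemma measurePreserving_shearY : MeasurePreserving shearY := by
  have h1 : MeasurePreserving (fun z : ℝ × ℝ => (z.1, z.2 - z.1)) (volume.prod volume)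
      (volume.prod volume) :=
    (MeasurePreserving.id volume).skew_product (g := fun x y : ℝ => y - x) (by fun_prop)
      (ae_of_all _ fun x => (measurePreserving_sub_right volume x).map_eq)
  exact h1.comp Measure.measurePreserving_swap

lemma hasFDerivAt_hat {h α β : ℝ} {p z : ℝ × ℝ}
    (hM : ∀ᶠ w : ℝ × ℝ in 𝓝 z,
      max |w.1 - p.1| (max |w.2 - p.2| |(w.1 - p.1) - (w.2 - p.2)|) =
        α * (w.1 - p.1) + β * (w.2 - p.2)) (hh : 0 < h)
    (hne : α * (z.1 - p.1) + β * (z.2 - p.2) ≠ h) :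
    HasFDerivAt (hat h p)
      ((if α * (z.1 - p.1) + β * (z.2 - p.2) < h then -h⁻¹ else 0) •
        (α • ContinuousLinearMap.fst ℝ ℝ ℝ + β • ContinuousLinearMap.snd ℝ ℝ ℝ)) z := by
  have hcont : Continuous fun w : ℝ × ℝ => α * (w.1 - p.1) + β * (w.2 - p.2) := by fun_prop
  split_ifs with hlt
  · have hlin : HasFDerivAt (fun w : ℝ × ℝ => 1 - (α * (w.1 - p.1) + β * (w.2 - p.2)) / h)
        (-h⁻¹ • (α • ContinuousLinearMap.fst ℝ ℝ ℝ + β • ContinuousLinearMap.snd ℝ ℝ ℝ)) z := by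
      have h1 : HasFDerivAt (fun w : ℝ × ℝ => α * (w.1 - p.1) + β * (w.2 - p.2))
          (α • ContinuousLinearMap.fst ℝ ℝ ℝ + β • ContinuousLinearMap.snd ℝ ℝ ℝ) z :=
        ((hasFDerivAt_fst.sub_const p.1).const_mul α).add
          ((hasFDerivAt_snd.sub_const p.2).const_mul β)
      simp only [div_eq_inv_mul]
      exact ((h1.const_mul h⁻¹).const_sub 1).congr_fderiv (neg_smul _ _).symm
    refine hlin.congr_of_eventuallyEq ?_
    filter_upwards [hM, hcont.continuousAt.eventually_lt continuousAt_const hlt] with w hw hw'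
    rw [hat, hw, max_eq_right]
    rw [sub_nonneg, div_le_one hh]
    exact hw'.le
  · rw [zero_smul]
    refine (hasFDerivAt_const (0 : ℝ) z).congr_of_eventuallyEq ?_
    have hgt := lt_of_le_of_ne (not_lt.1 hlt) hne.symm
    filter_upwards [hM, continuousAt_const.eventually_lt hcont.continuousAt hgt] with w hw hw'
    rw [hat, hw, max_eq_left]
    rw [sub_nonpos, one_le_div hh]
    exact hw'.le

/-- The gradient of the hat function off the lines of the mesh. -/
lemma grad_hat_eq {h : ℝ} (hh : 0 < h) {p z : ℝ × ℝ}
    (h1 : z.1 - p.1 ∉ ({0, h, -h} : Set ℝ)) (h2 : z.2 - p.2 ∉ ({0, h, -h} : Set ℝ))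
    (h3 : (z.1 - z.2) - (p.1 - p.2) ∉ ({0, h, -h} : Set ℝ)) :
    pdx (hat h p) z = h⁻¹ * (squareInd h (p.1 - h) (p.1 - p.2 - h) (shearX z) -
        squareInd h p.1 (p.1 - p.2) (shearX z)) ∧
    pdy (hat h p) z = h⁻¹ * (squareInd h (p.2 - h) (p.1 - p.2) (shearY z) -
        squareInd h p.2 (p.1 - p.2 - h) (shearY z)) := by
  have eX : shearX z = (z.1, z.1 - z.2) := rfl
  have eY : shearY z = (z.2, z.1 - z.2) := rfl
  simp only [Set.mem_insert_iff, Set.mem_singleton_iff, not_or] at h1 h2 h3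
  obtain ⟨h1, h1p, h1n⟩ := h1
  obtain ⟨h2, h2p, h2n⟩ := h2
  obtain ⟨h3, h3p, h3n⟩ := h3
  -- It suffices to find the linear form that is the maximum near `z`.
  have key : ∀ α β : ℝ, (∀ᶠ w : ℝ × ℝ in 𝓝 z,
      max |w.1 - p.1| (max |w.2 - p.2| |(w.1 - p.1) - (w.2 - p.2)|) =
        α * (w.1 - p.1) + β * (w.2 - p.2)) → α * (z.1 - p.1) + β * (z.2 - p.2) ≠ h →
      pdx (hat h p) z = (if α * (z.1 - p.1) + β * (z.2 - p.2) < h then -h⁻¹ else 0) * α ∧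
      pdy (hat h p) z = (if α * (z.1 - p.1) + β * (z.2 - p.2) < h then -h⁻¹ else 0) * β := by
    intro α β hM hne
    have hd := (hasFDerivAt_hat hM hh hne).fderiv
    constructor
    · rw [pdx, hd]; split_ifs <;> simp
    · rw [pdy, hd]; split_ifs <;> simp
  have c1 : Continuous fun w : ℝ × ℝ => w.1 - p.1 := by fun_prop
  have c2 : Continuous fun w : ℝ × ℝ => w.2 - p.2 := by fun_prop
  have c3 : Continuous fun w : ℝ × ℝ => (w.1 - w.2) - (p.1 - p.2) := by fun_prop
  have pos : ∀ {f : ℝ × ℝ → ℝ}, Continuous f → 0 < f z → ∀ᶠ w in 𝓝 z, 0 < f w :=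
    fun hf hz => continuousAt_const.eventually_lt hf.continuousAt hz
  have neg : ∀ {f : ℝ × ℝ → ℝ}, Continuous f → f z < 0 → ∀ᶠ w in 𝓝 z, f w < 0 :=
    fun hf hz => hf.continuousAt.eventually_lt continuousAt_const hz
  rw [eX, eY]
  rcases lt_or_gt_of_ne h1 with s1 | s1 <;> rcases lt_or_gt_of_ne h2 with s2 | s2 <;>
    rcases lt_or_gt_of_ne h3 with s3 | s3
  · obtain ⟨kx, ky⟩ := key (-1) 0 (by
      filter_upwards [neg c1 s1, neg c2 s2, neg c3 s3] with w w1 w2 w3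
      have w4 : (w.1 - p.1) - (w.2 - p.2) < 0 := by linarith
      rw [abs_of_neg w1, abs_of_neg w2, abs_of_neg w4]
      simp only [max_def]
      split_ifs <;> linarith) (by contrapose! h1n; linarith)
    rw [kx, ky]
    simp only [squareInd, pulse_sub_of_neg s1, pulse_of_neg s1, pulse_sub_of_neg s2, pulse_of_neg s2,
      pulse_sub_of_neg s3, pulse_of_neg s3]
    constructor <;> split_ifs <;> first | ring1 | linarith
  · obtain ⟨kx, ky⟩ := key 0 (-1) (by
      filter_upwards [neg c1 s1, neg c2 s2, pos c3 s3] with w w1 w2 w3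
      have w4 : 0 < (w.1 - p.1) - (w.2 - p.2) := by linarith
      rw [abs_of_neg w1, abs_of_neg w2, abs_of_pos w4]
      simp only [max_def]
      split_ifs <;> linarith) (by contrapose! h2n; linarith)
    rw [kx, ky]
    simp only [squareInd, pulse_sub_of_neg s1, pulse_of_neg s1, pulse_sub_of_neg s2, pulse_of_neg s2,
      pulse_sub_of_pos s3, pulse_of_pos s3]
    constructor <;> split_ifs <;> first | ring1 | linarith
  · obtain ⟨kx, ky⟩ := key (-1) 1 (by
      filter_upwards [neg c1 s1, pos c2 s2, neg c3 s3] with w w1 w2 w3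
      have w4 : (w.1 - p.1) - (w.2 - p.2) < 0 := by linarith
      rw [abs_of_neg w1, abs_of_pos w2, abs_of_neg w4]
      simp only [max_def]
      split_ifs <;> linarith) (by contrapose! h3n; linarith)
    rw [kx, ky]
    simp only [squareInd, pulse_sub_of_neg s1, pulse_of_neg s1, pulse_sub_of_pos s2, pulse_of_pos s2,
      pulse_sub_of_neg s3, pulse_of_neg s3]
    constructor <;> split_ifs <;> first | ring1 | linarith
  · linarith
  · linarith
  · obtain ⟨kx, ky⟩ := key 1 (-1) (by
      filter_upwards [pos c1 s1, neg c2 s2, pos c3 s3] with w w1 w2 w3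
      have w4 : 0 < (w.1 - p.1) - (w.2 - p.2) := by linarith
      rw [abs_of_pos w1, abs_of_neg w2, abs_of_pos w4]
      simp only [max_def]
      split_ifs <;> linarith) (by contrapose! h3p; linarith)
    rw [kx, ky]
    simp only [squareInd, pulse_sub_of_pos s1, pulse_of_pos s1, pulse_sub_of_neg s2, pulse_of_neg s2,
      pulse_sub_of_pos s3, pulse_of_pos s3]
    constructor <;> split_ifs <;> first | ring1 | linarith
  · obtain ⟨kx, ky⟩ := key 0 1 (by
      filter_upwards [pos c1 s1, pos c2 s2, neg c3 s3] with w w1 w2 w3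
      have w4 : (w.1 - p.1) - (w.2 - p.2) < 0 := by linarith
      rw [abs_of_pos w1, abs_of_pos w2, abs_of_neg w4]
      simp only [max_def]
      split_ifs <;> linarith) (by contrapose! h2p; linarith)
    rw [kx, ky]
    simp only [squareInd, pulse_sub_of_pos s1, pulse_of_pos s1, pulse_sub_of_pos s2, pulse_of_pos s2,
      pulse_sub_of_neg s3, pulse_of_neg s3]
    constructor <;> split_ifs <;> first | ring1 | linarith
  · obtain ⟨kx, ky⟩ := key 1 0 (by
      filter_upwards [pos c1 s1, pos c2 s2, pos c3 s3] with w w1 w2 w3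
      have w4 : 0 < (w.1 - p.1) - (w.2 - p.2) := by linarith
      rw [abs_of_pos w1, abs_of_pos w2, abs_of_pos w4]
      simp only [max_def]
      split_ifs <;> linarith) (by contrapose! h1p; linarith)
    rw [kx, ky]
    simp only [squareInd, pulse_sub_of_pos s1, pulse_of_pos s1, pulse_sub_of_pos s2, pulse_of_pos s2,
      pulse_sub_of_pos s3, pulse_of_pos s3]
    constructor <;> split_ifs <;> first | ring1 | linarith

lemma ae_grad_hat_eq {h : ℝ} (hh : 0 < h) (p : ℝ × ℝ) :
    ∀ᵐ z : ℝ × ℝ,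
      pdx (hat h p) z = h⁻¹ * (squareInd h (p.1 - h) (p.1 - p.2 - h) (shearX z) -
        squareInd h p.1 (p.1 - p.2) (shearX z)) ∧
      pdy (hat h p) z = h⁻¹ * (squareInd h (p.2 - h) (p.1 - p.2) (shearY z) -
        squareInd h p.2 (p.1 - p.2 - h) (shearY z)) := by
  have hline : ∀ c : ℝ, ∀ᵐ s : ℝ, s - c ∉ ({0, h, -h} : Set ℝ) := by
    intro c
    have hfin : ((fun s : ℝ => s - c) ⁻¹' ({0, h, -h} : Set ℝ)).Finite :=
      (Set.toFinite _).preimage (sub_left_injective.injOn)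
    exact measure_eq_zero_iff_ae_notMem.1 (hfin.measure_zero volume)
  have q1 : Measure.QuasiMeasurePreserving (Prod.fst : ℝ × ℝ → ℝ) volume volume :=
    Measure.quasiMeasurePreserving_fst
  have q2 : Measure.QuasiMeasurePreserving (Prod.snd : ℝ × ℝ → ℝ) volume volume :=
    Measure.quasiMeasurePreserving_snd
  filter_upwards [q1.ae (hline p.1), q2.ae (hline p.2),
    (q2.comp measurePreserving_shearX.quasiMeasurePreserving).ae (hline (p.1 - p.2))]
    with z z1 z2 z3
  exact grad_hat_eq hh z1 z2 z3

/-- The Dirichlet product of a coarse and a fine hat, as a count of common squares. -/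
lemma dirR_hat_hat {k : ℝ} (hk : 0 < k) (p : ℝ × ℝ) (a b : ℤ) :
    dirR (hat (2 * k) p) (hat k (p + ((a : ℝ) * k, (b : ℝ) * k))) =
      ((cellOverlap (-2) (a - 1) * cellOverlap (-2) (a - b - 1) -
          cellOverlap 0 (a - 1) * cellOverlap 0 (a - b - 1)) -
        (cellOverlap (-2) a * cellOverlap (-2) (a - b) -
          cellOverlap 0 a * cellOverlap 0 (a - b)) +
        (cellOverlap (-2) (b - 1) * cellOverlap 0 (a - b) -
          cellOverlap 0 (b - 1) * cellOverlap (-2) (a - b)) -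
        (cellOverlap (-2) b * cellOverlap 0 (a - b - 1) -
          cellOverlap 0 b * cellOverlap (-2) (a - b - 1))) / 2 := by
  have hint : ∀ (e : (ℝ × ℝ) ≃ᵐ (ℝ × ℝ)), MeasurePreserving e → ∀ A q r : ℝ,
      Integrable (fun z => A * squareInd k q r (e z)) ∧
        ∫ z, A * squareInd k q r (e z) = A * k ^ 2 := by
    intro e he A q r
    refine ⟨(he.integrable_comp_of_integrable (integrable_squareInd k q r)).const_mul A, ?_⟩
    rw [integral_const_mul, he.integral_comp', integral_squareInd hk.le]
  obtain ⟨i1, v1⟩ := hint shearX measurePreserving_shearX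
    ((cellOverlap (-2) (a - 1) * cellOverlap (-2) (a - b - 1) -
      cellOverlap 0 (a - 1) * cellOverlap 0 (a - b - 1)) / (2 * k ^ 2))
    (p.1 + (a - 1 : ℤ) * k) (p.1 - p.2 + (a - b - 1 : ℤ) * k)
  obtain ⟨i2, v2⟩ := hint shearX measurePreserving_shearX
    ((cellOverlap (-2) a * cellOverlap (-2) (a - b) -
      cellOverlap 0 a * cellOverlap 0 (a - b)) / (2 * k ^ 2))
    (p.1 + a * k) (p.1 - p.2 + (a - b : ℤ) * k)
  obtain ⟨i3, v3⟩ := hint shearY measurePreserving_shearY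
    ((cellOverlap (-2) (b - 1) * cellOverlap 0 (a - b) -
      cellOverlap 0 (b - 1) * cellOverlap (-2) (a - b)) / (2 * k ^ 2))
    (p.2 + (b - 1 : ℤ) * k) (p.1 - p.2 + (a - b : ℤ) * k)
  obtain ⟨i4, v4⟩ := hint shearY measurePreserving_shearY
    ((cellOverlap (-2) b * cellOverlap 0 (a - b - 1) -
      cellOverlap 0 b * cellOverlap (-2) (a - b - 1)) / (2 * k ^ 2))
    (p.2 + b * k) (p.1 - p.2 + (a - b - 1 : ℤ) * k)
  have hv := integral_sub ((i1.sub i2).add i3) i4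
  have hv' := integral_add (i1.sub i2) i3
  have hv'' := integral_sub i1 i2
  simp only [Pi.sub_apply, Pi.add_apply] at hv hv' hv''
  rw [hv', hv'', v1, v2, v3, v4] at hv
  rw [dirR]
  refine (integral_congr_ae ?_).trans (hv.trans (by field_simp))
  filter_upwards [ae_grad_hat_eq (mul_pos two_pos hk) p,
    ae_grad_hat_eq hk (p + ((a : ℝ) * k, (b : ℝ) * k))] with z hc hf
  have m := fun q r i j m n w => squareInd_mul_squareInd hk q r i j m n w
  have x11 := m p.1 (p.1 - p.2) (-2) (-2) (a - 1) (a - b - 1) (shearX z)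
  have x21 := m p.1 (p.1 - p.2) 0 0 (a - 1) (a - b - 1) (shearX z)
  have x12 := m p.1 (p.1 - p.2) (-2) (-2) a (a - b) (shearX z)
  have x22 := m p.1 (p.1 - p.2) 0 0 a (a - b) (shearX z)
  have y11 := m p.2 (p.1 - p.2) (-2) 0 (b - 1) (a - b) (shearY z)
  have y21 := m p.2 (p.1 - p.2) 0 (-2) (b - 1) (a - b) (shearY z)
  have y12 := m p.2 (p.1 - p.2) (-2) 0 b (a - b - 1) (shearY z)
  have y22 := m p.2 (p.1 - p.2) 0 (-2) b (a - b - 1) (shearY z)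
  have n0 : ∀ q : ℝ, q + ((0 : ℤ) : ℝ) * k = q := fun q => by simp
  have n2 : ∀ q : ℝ, q + ((-2 : ℤ) : ℝ) * k = q - 2 * k := fun q => by push_cast; ring
  have na : p.1 + (a : ℝ) * k - k = p.1 + (a - 1 : ℤ) * k := by push_cast; ring
  have nb : p.2 + (b : ℝ) * k - k = p.2 + (b - 1 : ℤ) * k := by push_cast; ring
  have nc : p.1 + (a : ℝ) * k - (p.2 + b * k) = p.1 - p.2 + (a - b : ℤ) * k := by
    push_cast; ring
  have nd : p.1 - p.2 + (a - b : ℤ) * k - k = p.1 - p.2 + (a - b - 1 : ℤ) * k := by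
    push_cast; ring
  simp only [n0, n2] at x11 x21 x12 x22 y11 y21 y12 y22
  rw [hc.1, hc.2, hf.1, hf.2]
  simp only [Prod.fst_add, Prod.snd_add, na, nb, nc, nd]
  have hk0 := hk.ne'
  have hi : (2 * k)⁻¹ * k⁻¹ = 1 / (2 * k ^ 2) := by field_simp
  linear_combination (1 / (2 * k ^ 2)) *
    (x11 - x21 - x12 + x22 + y11 - y21 - y12 + y22) + hi *
    ((squareInd (2 * k) (p.1 - 2 * k) (p.1 - p.2 - 2 * k) (shearX z) -
        squareInd (2 * k) p.1 (p.1 - p.2) (shearX z)) *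
      (squareInd k (p.1 + (a - 1 : ℤ) * k) (p.1 - p.2 + (a - b - 1 : ℤ) * k) (shearX z) -
        squareInd k (p.1 + a * k) (p.1 - p.2 + (a - b : ℤ) * k) (shearX z)) +
    (squareInd (2 * k) (p.2 - 2 * k) (p.1 - p.2) (shearY z) -
        squareInd (2 * k) p.2 (p.1 - p.2 - 2 * k) (shearY z)) *
      (squareInd k (p.2 + (b - 1 : ℤ) * k) (p.1 - p.2 + (a - b : ℤ) * k) (shearY z) -
        squareInd k (p.2 + b * k) (p.1 - p.2 + (a - b - 1 : ℤ) * k) (shearY z)))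

/-- The complete table of Dirichlet inner products between the coarse hat at p of
mesh h and every fine hat of mesh h/2 at a half-grid vertex p + (a·h/2, b·h/2):
1/2 for (±1,0),(0,±1); 1 for ±(1,1); −1/2 for (±2,0),(0,±2),±(2,1),±(1,2);
−1 for ±(1,−1); and 0 for ±(2,2) and all other half-grid vertices. -/
theorem stmt6 (h : ℝ) (hh : 0 < h) (p : ℝ × ℝ) (a b : ℤ) :
    dirR (hat h p) (hat (h / 2) (p + ((a : ℝ) * (h / 2), (b : ℝ) * (h / 2)))) =
      hatCoef a b := by
  have hd := dirR_hat_hat (half_pos hh) p a b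
  rw [mul_div_cancel₀ h two_ne_zero] at hd
  rw [hd]
  by_cases hab : (-2 ≤ a ∧ a ≤ 2) ∧ -2 ≤ b ∧ b ≤ 2
  · obtain ⟨⟨a1, a2⟩, b1, b2⟩ := hab
    interval_cases a <;> interval_cases b <;> norm_num [cellOverlap, hatCoef]
  · have hz : hatCoef a b = 0 := by
      simp only [hatCoef, Finset.mem_insert, Finset.mem_singleton, Prod.mk.injEq]
      rw [if_neg, if_neg, if_neg, if_neg, if_neg] <;> omega
    have hov : ∀ i m j n : ℤ, ¬((m = i ∨ m = i + 1) ∧ (n = j ∨ n = j + 1)) →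
        cellOverlap i m * cellOverlap j n = 0 := by
      intro i m j n hn
      unfold cellOverlap
      split_ifs <;> simp_all
    rw [hz, hov, hov, hov, hov, hov, hov, hov, hov] <;> first | omega | norm_num
end
end

section
/- The interior wavelet of second kind ψ⁴ = −φ¹_{(2i,2k)} + φ¹_{(2i−1,2k)} + φ¹_{(2i,2k−1)} + φ¹_{(2i−1,2k−1)} on the fine type-1 triangulation of mesh h/2 is orthogonal, in the Dirichlet inner product ⟨u,v⟩_s = ∫ ∇u·∇v, to every coarse hat function φ⁰_{(m,n)} of mesh h. -/
noncomputable section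
open MeasureTheory

/-- The fine hat function of mesh h/2 centered at (a·h/2, b·h/2). -/
def fineHat (h : ℝ) (a b : ℤ) : (ℝ × ℝ) → ℝ :=
  hat (h / 2) ((a : ℝ) * (h / 2), (b : ℝ) * (h / 2))

/-- The coarse hat function of mesh h centered at (m·h, n·h). -/
def coarseHat (h : ℝ) (m n : ℤ) : (ℝ × ℝ) → ℝ :=
  hat h ((m : ℝ) * h, (n : ℝ) * h)

open Filter Topology

/-- The indicator function of the `a`-th cell of the one-dimensional grid of mesh `d`. -/
def cell (d : ℝ) (a : ℤ) : ℝ → ℝ :=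
  (Set.Ico ((a : ℝ) * d) (((a : ℝ) + 1) * d)).indicator 1

/-- `f` is integrable with integral zero. -/
def MeanZero {α : Type*} [MeasureSpace α] (f : α → ℝ) : Prop :=
  Integrable f ∧ ∫ x, f x = 0

namespace MeanZero

variable {α : Type*} [MeasureSpace α] {f g : α → ℝ}

lemma add (hf : MeanZero f) (hg : MeanZero g) : MeanZero (fun x => f x + g x) :=
  ⟨hf.1.add hg.1, by rw [integral_add hf.1 hg.1, hf.2, hg.2, add_zero]⟩

lemma const_mul (c : ℝ) (hf : MeanZero f) : MeanZero (fun x => c * f x) :=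
  ⟨hf.1.const_mul c, by rw [integral_const_mul, hf.2, mul_zero]⟩

lemma congr (hf : MeanZero f) (h : g =ᵐ[volume] f) : MeanZero g :=
  ⟨hf.1.congr h.symm, by rw [integral_congr_ae h, hf.2]⟩

lemma mul_prod_left {f g : ℝ → ℝ} (hf : MeanZero f) (hg : Integrable g) :
    MeanZero (fun z : ℝ × ℝ => f z.1 * g z.2) :=
  ⟨hf.1.mul_prod hg, by
    rw [Measure.volume_eq_prod, integral_prod_mul, hf.2, zero_mul]⟩

lemma mul_prod_right {f g : ℝ → ℝ} (hf : Integrable f) (hg : MeanZero g) :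
    MeanZero (fun z : ℝ × ℝ => f z.1 * g z.2) :=
  ⟨hf.mul_prod hg.1, by
    rw [Measure.volume_eq_prod, integral_prod_mul, hg.2, mul_zero]⟩

lemma comp_shear {f : ℝ × ℝ → ℝ} (hf : MeanZero f) :
    MeanZero (fun z : ℝ × ℝ => f (z.1, z.2 - z.1)) := by
  have hm : MeasurePreserving (MeasurableEquiv.shearAddRight ℝ).symm := by
    have h := measurePreserving_prod_add (volume : Measure ℝ) (volume : Measure ℝ)
    exact MeasurePreserving.symm (MeasurableEquiv.shearAddRight ℝ) h
  have he : (fun z : ℝ × ℝ => f (z.1, z.2 - z.1)) =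
      f ∘ (MeasurableEquiv.shearAddRight ℝ).symm := by
    funext z
    simp [MeasurableEquiv.shearAddRight, sub_eq_neg_add]
  rw [he]
  exact ⟨(hm.integrable_comp_emb (MeasurableEquiv.measurableEmbedding _)).2 hf.1,
    (hm.integral_comp (MeasurableEquiv.measurableEmbedding _) f).trans hf.2⟩

lemma comp_swap {f : ℝ × ℝ → ℝ} (hf : MeanZero f) :
    MeanZero (fun z : ℝ × ℝ => f z.swap) :=
  ⟨Integrable.swap (μ := volume) (ν := volume) hf.1,
    (integral_prod_swap (μ := volume) (ν := volume) f).trans hf.2⟩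

end MeanZero

lemma integrable_cell (d : ℝ) (a : ℤ) : Integrable (cell d a) :=
  (integrable_indicator_iff measurableSet_Ico).2 (integrableOn_const (by simp))

lemma integral_cell {d : ℝ} (hd : 0 < d) (a : ℤ) : ∫ s, cell d a s = d := by
  rw [cell, integral_indicator_one measurableSet_Ico, Measure.real, Real.volume_Ico,
    ENNReal.toReal_ofReal] <;> nlinarith

/-- A half-mesh cell lies in exactly one cell of the coarse grid. -/
lemma cell_mul_cell {h : ℝ} (hh : 0 < h) (a M : ℤ) (s : ℝ) :
    cell (h / 2) a s * cell h M s = if a / 2 = M then cell (h / 2) a s else 0 := by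
  by_cases hs : s ∈ Set.Ico ((a : ℝ) * (h / 2)) (((a : ℝ) + 1) * (h / 2))
  swap
  · simp [cell, hs]
  obtain ⟨h1, h2⟩ := hs
  have key : a / 2 = M ↔ s ∈ Set.Ico ((M : ℝ) * h) (((M : ℝ) + 1) * h) := by
    constructor
    · rintro rfl
      have l1 : ((2 * (a / 2) : ℤ) : ℝ) ≤ a := by exact_mod_cast (by omega)
      have l2 : (a : ℝ) + 1 ≤ ((2 * (a / 2) + 2 : ℤ) : ℝ) := by exact_mod_cast (by omega)
      push_cast at l1 l2
      constructor <;> nlinarith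
    · rintro ⟨h3, h4⟩
      have l1 : (a : ℝ) < 2 * M + 2 := by
        by_contra! hc
        nlinarith
      have l2 : (2 * M : ℝ) < a + 1 := by
        by_contra! hc
        nlinarith
      norm_cast at l1 l2
      omega
  by_cases hM : a / 2 = M
  · simp [cell, hM, key.1 hM]
  · simp [cell, hM, mt key.2 hM]

lemma integrable_cell_mul_cell {h : ℝ} (hh : 0 < h) (a M : ℤ) :
    Integrable (fun s => cell (h / 2) a s * cell h M s) := by
  simp_rw [cell_mul_cell hh]
  split_ifs
  exacts [integrable_cell _ _, integrable_zero _ _ _]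

/-- The difference of the two halves of a coarse cell is orthogonal to every coarse cell. -/
lemma meanZero_cell_sub_cell {h : ℝ} (hh : 0 < h) (j M : ℤ) :
    MeanZero (fun s => (cell (h / 2) (2 * j + 1) s - cell (h / 2) (2 * j) s) * cell h M s) := by
  simp_rw [sub_mul]
  refine ⟨(integrable_cell_mul_cell hh _ _).sub (integrable_cell_mul_cell hh _ _), ?_⟩
  rw [integral_sub (integrable_cell_mul_cell hh _ _) (integrable_cell_mul_cell hh _ _)]
  simp_rw [cell_mul_cell hh, show (2 * j + 1) / 2 = j by omega, show 2 * j / 2 = j by omega]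
  split_ifs
  · rw [integral_cell (half_pos hh), integral_cell (half_pos hh), sub_self]
  · simp

/-- The `x`-derivative of the wavelet integrates to zero against every coarse parallelogram. -/
lemma meanZero_wavelet_mul_cell {h : ℝ} (hh : 0 < h) (i p M N : ℤ) :
    MeanZero (fun z : ℝ × ℝ =>
      (cell (h / 2) (2 * i) z.1 *
          (cell (h / 2) (2 * (p - 1) + 1) z.2 - cell (h / 2) (2 * (p - 1)) z.2) +
        cell (h / 2) (2 * (i - 1)) z.1 *
          (cell (h / 2) (2 * p + 1) z.2 - cell (h / 2) (2 * p) z.2) +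
        (-2) * ((cell (h / 2) (2 * (i - 1) + 1) z.1 - cell (h / 2) (2 * (i - 1)) z.1) *
          cell (h / 2) (2 * p) z.2)) *
      (cell h M z.1 * cell h N z.2)) := by
  have h1 := MeanZero.mul_prod_right (integrable_cell_mul_cell hh (2 * i) M)
    (meanZero_cell_sub_cell hh (p - 1) N)
  have h2 := MeanZero.mul_prod_right (integrable_cell_mul_cell hh (2 * (i - 1)) M)
    (meanZero_cell_sub_cell hh p N)
  have h3 := MeanZero.mul_prod_left (meanZero_cell_sub_cell hh (i - 1) M)
    (integrable_cell_mul_cell hh (2 * p) N)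
  refine ((h1.add h2).add (h3.const_mul (-2))).congr (Eventually.of_forall fun z => ?_)
  ring

lemma ae_fst_ne (c : ℝ) : ∀ᵐ z : ℝ × ℝ, z.1 ≠ c :=
  Measure.quasiMeasurePreserving_fst.ae (Measure.ae_ne volume c)

lemma ae_snd_ne (c : ℝ) : ∀ᵐ z : ℝ × ℝ, z.2 ≠ c :=
  Measure.quasiMeasurePreserving_snd.ae (Measure.ae_ne volume c)

lemma ae_snd_sub_fst_ne (c : ℝ) : ∀ᵐ z : ℝ × ℝ, z.2 - z.1 ≠ c := by
  have hm := measurePreserving_prod_add (volume : Measure ℝ) (volume : Measure ℝ)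
  have hs := MeasurePreserving.symm (MeasurableEquiv.shearAddRight ℝ) hm
  filter_upwards [hs.quasiMeasurePreserving.ae (ae_snd_ne c)] with z hz
  simpa [MeasurableEquiv.shearAddRight, sub_eq_neg_add] using hz

lemma pdx_of_eventuallyEq_affine {f : ℝ × ℝ → ℝ} {z : ℝ × ℝ} {α β γ : ℝ}
    (hf : f =ᶠ[𝓝 z] fun w => α + β * w.1 + γ * w.2) :
    DifferentiableAt ℝ f z ∧ pdx f z = β := by
  have h : HasFDerivAt (fun w : ℝ × ℝ => α + β * w.1 + γ * w.2)
      (β • ContinuousLinearMap.fst ℝ ℝ ℝ + γ • ContinuousLinearMap.snd ℝ ℝ ℝ) z :=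
    ((hasFDerivAt_fst.const_mul β).const_add α).add (hasFDerivAt_snd.const_mul γ)
  have h' := h.congr_of_eventuallyEq hf
  refine ⟨h'.differentiableAt, ?_⟩
  rw [pdx, h'.fderiv]
  simp

/-- The gauge whose unit ball is the hexagon supporting the hat function. -/
def hexGauge (u v : ℝ) : ℝ := max |u| (max |v| |u - v|)

lemma hexGauge_ne {d u v : ℝ} (hd : 0 ≤ d) (h1 : u ≠ d) (h2 : u ≠ -d) (h3 : v ≠ d)
    (h4 : v ≠ -d) (h5 : v - u ≠ d) (h6 : v - u ≠ -d) : hexGauge u v ≠ d := by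
  have hu : |u| ≠ d := by simp [abs_eq hd, h1, h2]
  have hv : |v| ≠ d := by simp [abs_eq hd, h3, h4]
  have hw : |u - v| ≠ d := by
    rw [abs_sub_comm]
    simp [abs_eq hd, h5, h6]
  unfold hexGauge
  rcases max_choice |v| |u - v| with h | h <;> rw [h] <;>
    [rcases max_choice |u| |v| with h | h; rcases max_choice |u| |u - v| with h | h] <;>
    rwa [h]

lemma continuous_hexGauge (p : ℝ × ℝ) :
    Continuous fun w : ℝ × ℝ => hexGauge (w.1 - p.1) (w.2 - p.2) := by
  unfold hexGauge
  fun_prop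

lemma hat_of_lt_hexGauge {d : ℝ} (hd : 0 < d) {p z : ℝ × ℝ}
    (hz : d < hexGauge (z.1 - p.1) (z.2 - p.2)) :
    DifferentiableAt ℝ (hat d p) z ∧ pdx (hat d p) z = 0 := by
  refine pdx_of_eventuallyEq_affine (α := 0) (γ := 0) ?_
  filter_upwards [(continuous_hexGauge p).continuousAt.eventually (lt_mem_nhds hz)] with w hw
  have := (one_lt_div hd).2 hw
  simp only [zero_mul, add_zero]
  exact max_eq_left (sub_nonpos.2 this.le)

lemma hat_of_hexGauge_lt {d : ℝ} (hd : 0 < d) {p z : ℝ × ℝ} {β γ : ℝ}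
    (hz : hexGauge (z.1 - p.1) (z.2 - p.2) < d)
    (hL : ∀ᶠ w in 𝓝 z, hexGauge (w.1 - p.1) (w.2 - p.2) =
      β * (w.1 - p.1) + γ * (w.2 - p.2)) :
    DifferentiableAt ℝ (hat d p) z ∧ pdx (hat d p) z = d⁻¹ * -β := by
  refine pdx_of_eventuallyEq_affine (α := 1 + d⁻¹ * (β * p.1 + γ * p.2)) (γ := d⁻¹ * -γ) ?_
  filter_upwards [hL, (continuous_hexGauge p).continuousAt.eventually (gt_mem_nhds hz)]
    with w h1 h2
  have := (div_lt_one hd).2 h2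
  refine (max_eq_right (sub_nonneg.2 this.le)).trans ?_
  change 1 - hexGauge (w.1 - p.1) (w.2 - p.2) / d = _
  rw [h1]
  ring

/-- Off the edges of the triangulation, the `x`-derivative of a hat function is `±d⁻¹` on two
parallelograms and vanishes elsewhere. -/
lemma hat_pdx_of_generic {d : ℝ} (hd : 0 < d) {p z : ℝ × ℝ}
    (h1 : z.1 - p.1 ≠ 0) (h2 : z.2 - p.2 ≠ 0) (h3 : (z.2 - p.2) - (z.1 - p.1) ≠ 0)
    (h4 : hexGauge (z.1 - p.1) (z.2 - p.2) ≠ d) :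
    DifferentiableAt ℝ (hat d p) z ∧ pdx (hat d p) z = d⁻¹ *
      ((if (-d ≤ z.1 - p.1 ∧ z.1 - p.1 < 0) ∧ 0 ≤ (z.2 - p.2) - (z.1 - p.1) ∧
          (z.2 - p.2) - (z.1 - p.1) < d then 1 else 0) -
        (if (0 ≤ z.1 - p.1 ∧ z.1 - p.1 < d) ∧ -d ≤ (z.2 - p.2) - (z.1 - p.1) ∧
          (z.2 - p.2) - (z.1 - p.1) < 0 then 1 else 0)) := by
  rcases h4.lt_or_gt with h4 | h4
  swap
  · have := hat_of_lt_hexGauge hd h4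
    rw [if_neg, if_neg]
    · simpa using this
    all_goals
      simp only [hexGauge, lt_max_iff, lt_abs] at h4
      grind
  have c1 : ContinuousAt (fun w : ℝ × ℝ => w.1 - p.1) z := by fun_prop
  have c2 : ContinuousAt (fun w : ℝ × ℝ => w.2 - p.2) z := by fun_prop
  have c3 : ContinuousAt (fun w : ℝ × ℝ => (w.2 - p.2) - (w.1 - p.1)) z := by fun_prop
  have key : ∃ β γ : ℝ, (∀ᶠ w in 𝓝 z, hexGauge (w.1 - p.1) (w.2 - p.2) =
      β * (w.1 - p.1) + γ * (w.2 - p.2)) ∧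
      β = (if 0 < z.1 - p.1 ∧ (z.2 - p.2) - (z.1 - p.1) < 0 then 1 else 0) -
        (if z.1 - p.1 < 0 ∧ 0 < (z.2 - p.2) - (z.1 - p.1) then 1 else 0) := by
    rcases h1.lt_or_gt with h1 | h1 <;> rcases h2.lt_or_gt with h2 | h2 <;>
      rcases h3.lt_or_gt with h3 | h3
    · refine ⟨0, -1, ?_, by grind⟩
      filter_upwards [c1.eventually (gt_mem_nhds h1), c2.eventually (gt_mem_nhds h2),
        c3.eventually (gt_mem_nhds h3)] with w _ _ _
      grind [hexGauge]
    · refine ⟨-1, 0, ?_, by grind⟩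
      filter_upwards [c1.eventually (gt_mem_nhds h1), c2.eventually (gt_mem_nhds h2),
        c3.eventually (lt_mem_nhds h3)] with w _ _ _
      grind [hexGauge]
    · linarith
    · refine ⟨-1, 1, ?_, by grind⟩
      filter_upwards [c1.eventually (gt_mem_nhds h1), c2.eventually (lt_mem_nhds h2),
        c3.eventually (lt_mem_nhds h3)] with w _ _ _
      grind [hexGauge]
    · refine ⟨1, -1, ?_, by grind⟩
      filter_upwards [c1.eventually (lt_mem_nhds h1), c2.eventually (gt_mem_nhds h2),
        c3.eventually (gt_mem_nhds h3)] with w _ _ _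
      grind [hexGauge]
    · linarith
    · refine ⟨1, 0, ?_, by grind⟩
      filter_upwards [c1.eventually (lt_mem_nhds h1), c2.eventually (lt_mem_nhds h2),
        c3.eventually (gt_mem_nhds h3)] with w _ _ _
      grind [hexGauge]
    · refine ⟨0, 1, ?_, by grind⟩
      filter_upwards [c1.eventually (lt_mem_nhds h1), c2.eventually (lt_mem_nhds h2),
        c3.eventually (lt_mem_nhds h3)] with w _ _ _
      grind [hexGauge]
  obtain ⟨β, γ, hL, hβ⟩ := key
  have := hat_of_hexGauge_lt hd h4 hL
  refine ⟨this.1, this.2.trans ?_⟩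
  simp only [hexGauge, max_lt_iff, abs_lt] at h4
  rw [hβ]
  congr 1
  grind

lemma cell_mul_cell_eq_ite (d : ℝ) (a b : ℤ) (s t : ℝ) :
    cell d a s * cell d b t =
      if (a * d ≤ s ∧ s < (a + 1) * d) ∧ b * d ≤ t ∧ t < (b + 1) * d then 1 else 0 := by
  simp [cell, Set.indicator_apply, ← ite_and, and_comm]

lemma hat_ae {d : ℝ} (hd : 0 < d) (a b : ℤ) :
    ∀ᵐ z : ℝ × ℝ, DifferentiableAt ℝ (hat d (a * d, b * d)) z ∧
      pdx (hat d (a * d, b * d)) z = d⁻¹ *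
        (cell d (a - 1) z.1 * cell d (b - a) (z.2 - z.1) -
          cell d a z.1 * cell d (b - a - 1) (z.2 - z.1)) := by
  filter_upwards [ae_fst_ne (a * d), ae_snd_ne (b * d), ae_snd_sub_fst_ne (b * d - a * d),
    ae_fst_ne (a * d + d), ae_snd_ne (b * d + d), ae_snd_sub_fst_ne (b * d - a * d + d),
    ae_fst_ne (a * d - d), ae_snd_ne (b * d - d), ae_snd_sub_fst_ne (b * d - a * d - d)]
    with z h1 h2 h3 h4 h5 h6 h7 h8 h9
  have h := hat_pdx_of_generic hd (p := (a * d, b * d)) (z := z) (sub_ne_zero.2 h1)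
    (sub_ne_zero.2 h2) (by grind) (hexGauge_ne hd.le (by grind) (by grind) (by grind)
    (by grind) (by grind) (by grind))
  refine ⟨h.1, h.2.trans ?_⟩
  rw [cell_mul_cell_eq_ite, cell_mul_cell_eq_ite]
  push_cast
  have e1 : ((a : ℝ) - 1) * d = a * d - d := by ring
  have e2 : ((a : ℝ) - 1 + 1) * d = a * d := by ring
  have e3 : ((b : ℝ) - a) * d = b * d - a * d := by ring
  have e4 : ((b : ℝ) - a + 1) * d = b * d - a * d + d := by ring
  have e5 : ((a : ℝ) + 1) * d = a * d + d := by ring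
  have e6 : ((b : ℝ) - a - 1) * d = b * d - a * d - d := by ring
  have e7 : ((b : ℝ) - a - 1 + 1) * d = b * d - a * d := by ring
  rw [e1, e2, e3, e4, e5, e6, e7]
  congr 2 <;> refine if_congr ?_ rfl rfl <;>
    refine and_congr (and_congr ?_ ?_) (and_congr ?_ ?_) <;>
    constructor <;> intro <;> linarith

lemma ae_pdx_wavelet {h : ℝ} (hh : 0 < h) (i k : ℤ) :
    ∀ᵐ z : ℝ × ℝ, pdx (fun x => -fineHat h (2 * i) (2 * k) x +
        fineHat h (2 * i - 1) (2 * k) x + fineHat h (2 * i) (2 * k - 1) x +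
        fineHat h (2 * i - 1) (2 * k - 1) x) z = (h / 2)⁻¹ *
      (cell (h / 2) (2 * i) z.1 * (cell (h / 2) (2 * (k - i - 1) + 1) (z.2 - z.1) -
          cell (h / 2) (2 * (k - i - 1)) (z.2 - z.1)) +
        cell (h / 2) (2 * (i - 1)) z.1 * (cell (h / 2) (2 * (k - i) + 1) (z.2 - z.1) -
          cell (h / 2) (2 * (k - i)) (z.2 - z.1)) +
        (-2) * ((cell (h / 2) (2 * (i - 1) + 1) z.1 - cell (h / 2) (2 * (i - 1)) z.1) *
          cell (h / 2) (2 * (k - i)) (z.2 - z.1))) := by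
  have hd := half_pos hh
  filter_upwards [hat_ae hd (2 * i) (2 * k), hat_ae hd (2 * i - 1) (2 * k),
    hat_ae hd (2 * i) (2 * k - 1), hat_ae hd (2 * i - 1) (2 * k - 1)]
    with z h1 h2 h3 h4
  have hs := ((h1.1.hasFDerivAt.neg.add h2.1.hasFDerivAt).add h3.1.hasFDerivAt).add
    h4.1.hasFDerivAt
  have e : pdx (fun x => -fineHat h (2 * i) (2 * k) x +
      fineHat h (2 * i - 1) (2 * k) x + fineHat h (2 * i) (2 * k - 1) x +
      fineHat h (2 * i - 1) (2 * k - 1) x) z =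
      -pdx (hat (h / 2) (((2 * i : ℤ) : ℝ) * (h / 2), ((2 * k : ℤ) : ℝ) * (h / 2))) z +
      pdx (hat (h / 2) (((2 * i - 1 : ℤ) : ℝ) * (h / 2), ((2 * k : ℤ) : ℝ) * (h / 2))) z +
      pdx (hat (h / 2) (((2 * i : ℤ) : ℝ) * (h / 2), ((2 * k - 1 : ℤ) : ℝ) * (h / 2))) z +
      pdx (hat (h / 2) (((2 * i - 1 : ℤ) : ℝ) * (h / 2), ((2 * k - 1 : ℤ) : ℝ) * (h / 2))) z := by
    exact congrArg (fun L : ℝ × ℝ →L[ℝ] ℝ => L (1, 0)) hs.fderiv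
  rw [e, h1.2, h2.2, h3.2, h4.2]
  rw [show 2 * (i - 1) + 1 = 2 * i - 1 by ring, show 2 * (i - 1) = 2 * i - 1 - 1 by ring,
    show 2 * k - 2 * i = 2 * (k - i) by ring,
    show 2 * k - (2 * i - 1) = 2 * (k - i) + 1 by ring,
    show 2 * k - 1 - 2 * i = 2 * (k - i - 1) + 1 by ring,
    show 2 * k - 1 - (2 * i - 1) = 2 * (k - i) by ring,
    show 2 * (k - i) + 1 - 1 = 2 * (k - i) by ring,
    show 2 * (k - i - 1) + 1 - 1 = 2 * (k - i - 1) by ring,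
    show 2 * (k - i) - 1 = 2 * (k - i - 1) + 1 by ring]
  ring

lemma meanZero_pdx_wavelet_mul_pdx {h : ℝ} (hh : 0 < h) (i k m n : ℤ) :
    MeanZero (fun z => pdx (fun x => -fineHat h (2 * i) (2 * k) x +
        fineHat h (2 * i - 1) (2 * k) x + fineHat h (2 * i) (2 * k - 1) x +
        fineHat h (2 * i - 1) (2 * k - 1) x) z * pdx (coarseHat h m n) z) := by
  have h1 := (meanZero_wavelet_mul_cell hh i (k - i) (m - 1) (n - m)).comp_shear
  have h2 := (meanZero_wavelet_mul_cell hh i (k - i) m (n - m - 1)).comp_shear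
  refine ((h1.const_mul ((h / 2)⁻¹ * h⁻¹)).add (h2.const_mul (-((h / 2)⁻¹ * h⁻¹)))).congr ?_
  filter_upwards [ae_pdx_wavelet hh i k, hat_ae hh m n] with z e1 e2
  rw [e1, coarseHat, e2.2]
  ring

lemma pdy_eq_pdx_swap (f : ℝ × ℝ → ℝ) (z : ℝ × ℝ) :
    pdy f z = pdx (fun x => f x.swap) z.swap := by
  have h := (ContinuousLinearEquiv.prodComm ℝ ℝ ℝ).comp_right_fderiv (f := f) (x := z.swap)
  have h' := congrArg (fun L : ℝ × ℝ →L[ℝ] ℝ => L (1, 0)) h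
  exact h'.symm

lemma hat_swap (d : ℝ) (p z : ℝ × ℝ) : hat d p z.swap = hat d p.swap z := by
  simp only [hat, Prod.fst_swap, Prod.snd_swap]
  rw [max_left_comm, abs_sub_comm (z.2 - p.1)]

/-- The interior wavelet of second kind
ψ⁴ = −φ¹_{(2i,2k)} + φ¹_{(2i−1,2k)} + φ¹_{(2i,2k−1)} + φ¹_{(2i−1,2k−1)}
is Dirichlet-orthogonal to every coarse hat function. -/
theorem stmt8 (h : ℝ) (hh : 0 < h) (i k m n : ℤ) :
    dirR
      (fun x => -fineHat h (2 * i) (2 * k) x + fineHat h (2 * i - 1) (2 * k) x +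
        fineHat h (2 * i) (2 * k - 1) x + fineHat h (2 * i - 1) (2 * k - 1) x)
      (coarseHat h m n) = 0 := by
  have hx := meanZero_pdx_wavelet_mul_pdx hh i k m n
  have hy := (meanZero_pdx_wavelet_mul_pdx hh k i n m).comp_swap
  refine (hx.add (hy.congr (Eventually.of_forall fun z => ?_))).2
  simp only [pdy_eq_pdx_swap, fineHat, coarseHat, hat_swap, Prod.swap_prod_mk]
  congr 2
  funext x
  ring
end
end
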